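/- Let X be a set and k a commutative ring with λ ∈ k. Let ΔX = {x^{(n)} : x ∈ X, n ≥ 0} and let k[ΔX] be the polynomial algebra on ΔX. Define d on generators by d(x^{(n)}) = x^{(n+1)} and extend to monomials by d(uw) = d(u)w + u d(w) + λ d(u)d(w), with d(1) = 0, extended linearly. Then (k[ΔX], d) is a differential algebra of weight λ, i.e., d(fg) = d(f)g + f d(g) + λ d(f) d(g) for all f, g ∈ k[ΔX]. -/

import Mathlib

open MvPolynomial

/-- On the polynomial algebra `k[ΔX]`, `ΔX = {x^{(n)}} = X × ℕ`, there is a `k`-linear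
map `d` with `d(x^{(n)}) = x^{(n+1)}`, `d 1 = 0`, satisfying the weight-`λ` Leibniz rule
on all of `k[ΔX]`: this makes `(k[ΔX], d)` a differential algebra of weight `λ`. -/
theorem free_differential_algebra_exists
    {k X : Type*} [CommRing k] (lam : k) :
    ∃ d : MvPolynomial (X × ℕ) k →ₗ[k] MvPolynomial (X × ℕ) k,
      (∀ (x : X) (n : ℕ), d (MvPolynomial.X (x, n)) = MvPolynomial.X (x, n + 1)) ∧
      d 1 = 0 ∧
      ∀ f g : MvPolynomial (X × ℕ) k,
        d (f * g) = d f * g + f * d g + lam • (d f * d g) := by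
  -- the algebra `A[ω]` with `ω² = λ ω`; `f ↦ f + d f ω` is an algebra morphism
  let φ : MvPolynomial (X × ℕ) k →ₐ[k]
      QuadraticAlgebra (MvPolynomial (X × ℕ) k) 0 (MvPolynomial.C lam) :=
    MvPolynomial.aeval fun p => ⟨MvPolynomial.X p, MvPolynomial.X (p.1, p.2 + 1)⟩
  have hX : ∀ p, φ (MvPolynomial.X p) = ⟨MvPolynomial.X p, MvPolynomial.X (p.1, p.2 + 1)⟩ :=
    fun p => MvPolynomial.aeval_X _ p
  have hre : ∀ f, (φ f).re = f := by
    intro f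
    induction f using MvPolynomial.induction_on with
    | C a =>
      have h : φ (MvPolynomial.C a) = algebraMap k _ a := φ.commutes a
      rw [h]
      rfl
    | add p q hp hq => rw [map_add, QuadraticAlgebra.re_add, hp, hq]
    | mul_X p i hp => rw [map_mul, QuadraticAlgebra.re_mul, hp, hX]; simp
  refine ⟨{ toFun := fun f => (φ f).im, map_add' := ?_, map_smul' := ?_ }, ?_, ?_, ?_⟩
  · intro f g; simp
  · intro c f; simp
  · intro x n; simp [hX]
  · simp
    rfl
  · intro f g
    simp only [LinearMap.coe_mk, AddHom.coe_mk, map_mul, QuadraticAlgebra.im_mul, hre,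
      MvPolynomial.smul_eq_C_mul]
    ring
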